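/- Let H be a weak Hopf algebra with bijective antipode. Then H is a right (H ⊗ H^op)-comodule algebra with coaction ρ(h) = h_{(2)} ⊗ (S^{-1}(h_{(1)}) ⊗ h_{(3)}): ρ is a coassociative counital comodule structure, ρ(hk) = ρ(h)ρ(k), and ρ(1) = 1_{[0]} ⊗ (ε̄_t ⊗ ε_t)(1_{[1]}) where ε̄_t ⊗ ε_t is the target map of H^op ⊗ H. -/

import Mathlib

open TensorProduct

structure WeakBialgebra (k H : Type*) [CommRing k] [Ring H] [Algebra k H] where
  comul : H →ₗ[k] H ⊗[k] H
  counit : H →ₗ[k] k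
  coassoc : ∀ h : H, (TensorProduct.assoc k H H H) ((comul.rTensor H) (comul h)) =
      (comul.lTensor H) (comul h)
  counit_left : ∀ h : H, (TensorProduct.lid k H) ((counit.rTensor H) (comul h)) = h
  counit_right : ∀ h : H, (TensorProduct.rid k H) ((counit.lTensor H) (comul h)) = h
  comul_mul : ∀ h g : H, comul (h * g) = comul h * comul g
  weak_unit_left : (comul.lTensor H) (comul 1) =
      (Algebra.TensorProduct.map (AlgHom.id k H)
        (Algebra.TensorProduct.includeLeft : H →ₐ[k] H ⊗[k] H)) (comul 1) *
      (Algebra.TensorProduct.includeRight : (H ⊗[k] H) →ₐ[k] H ⊗[k] (H ⊗[k] H)) (comul 1)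
  weak_unit_right : (comul.lTensor H) (comul 1) =
      (Algebra.TensorProduct.includeRight : (H ⊗[k] H) →ₐ[k] H ⊗[k] (H ⊗[k] H)) (comul 1) *
      (Algebra.TensorProduct.map (AlgHom.id k H)
        (Algebra.TensorProduct.includeLeft : H →ₐ[k] H ⊗[k] H)) (comul 1)
  weak_counit₁ : ∀ h g l : H, counit (h * g * l) =
      (LinearMap.mul' k k) ((TensorProduct.map counit counit)
        ((h ⊗ₜ[k] (1 : H)) * comul g * ((1 : H) ⊗ₜ[k] l)))
  weak_counit₂ : ∀ h g l : H, counit (h * g * l) =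
      (LinearMap.mul' k k) ((TensorProduct.map counit counit)
        ((h ⊗ₜ[k] (1 : H)) * (TensorProduct.comm k H H) (comul g) * ((1 : H) ⊗ₜ[k] l)))

namespace WeakBialgebra

variable {k H : Type*} [CommRing k] [Ring H] [Algebra k H] (W : WeakBialgebra k H)

/-- The target map `ε_t(h) = ε(1_{(1)}h)1_{(2)}`. -/
noncomputable def εt : H →ₗ[k] H :=
  (TensorProduct.lid k H).toLinearMap ∘ₗ (W.counit.rTensor H) ∘ₗ
    (LinearMap.mulLeft k (W.comul 1)) ∘ₗ
    (Algebra.TensorProduct.includeLeft : H →ₐ[k] H ⊗[k] H).toLinearMap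

/-- The source map `ε_s(h) = 1_{(1)}ε(h1_{(2)})`. -/
noncomputable def εs : H →ₗ[k] H :=
  (TensorProduct.rid k H).toLinearMap ∘ₗ (W.counit.lTensor H) ∘ₗ
    (LinearMap.mulRight k (W.comul 1)) ∘ₗ
    (Algebra.TensorProduct.includeRight : H →ₐ[k] H ⊗[k] H).toLinearMap

/-- `ε̄_t(h) = ε(h1_{(1)})1_{(2)}`. -/
noncomputable def εt' : H →ₗ[k] H :=
  (TensorProduct.lid k H).toLinearMap ∘ₗ (W.counit.rTensor H) ∘ₗ
    (LinearMap.mulRight k (W.comul 1)) ∘ₗ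
    (Algebra.TensorProduct.includeLeft : H →ₐ[k] H ⊗[k] H).toLinearMap

/-- `ε̄_s(h) = ε(1_{(2)}h)1_{(1)}`. -/
noncomputable def εs' : H →ₗ[k] H :=
  (TensorProduct.rid k H).toLinearMap ∘ₗ (W.counit.lTensor H) ∘ₗ
    (LinearMap.mulLeft k (W.comul 1)) ∘ₗ
    (Algebra.TensorProduct.includeRight : H →ₐ[k] H ⊗[k] H).toLinearMap

end WeakBialgebra

/-- A weak Hopf algebra: a weak bialgebra with an antipode. -/
structure WeakHopf (k H : Type*) [CommRing k] [Ring H] [Algebra k H] where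
  W : WeakBialgebra k H
  S : H →ₗ[k] H
  S_conv_id : ∀ h : H, (LinearMap.mul' k H) ((S.rTensor H) (W.comul h)) = W.εs h
  id_conv_S : ∀ h : H, (LinearMap.mul' k H) ((S.lTensor H) (W.comul h)) = W.εt h
  S_conv_id_conv_S : ∀ h : H, (LinearMap.mul' k H) ((LinearMap.lTensor H (LinearMap.mul' k H))
      ((TensorProduct.map S (TensorProduct.map LinearMap.id S))
        ((W.comul.lTensor H) (W.comul h)))) = S h

section ComoduleAlgebra

variable {k H : Type*} [CommRing k] [Ring H] [Algebra k H]

/-- The coaction `ρ(h) = h₍₂₎ ⊗ (S⁻¹(h₍₁₎) ⊗ h₍₃₎)` of `H^op ⊗ H` on `H`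
(first tensorand of the coefficient algebra is the opposite algebra `H^op`). -/
noncomputable def weakHopfDoubleCoaction (WH : WeakHopf k H) (Sinv : H →ₗ[k] H) :
    H →ₗ[k] H ⊗[k] (Hᵐᵒᵖ ⊗[k] H) :=
  (LinearMap.lTensor H
      (TensorProduct.map ((MulOpposite.opLinearEquiv k).toLinearMap ∘ₗ Sinv)
        (LinearMap.id))) ∘ₗ
    (TensorProduct.assoc k H H H).toLinearMap ∘ₗ
    (LinearMap.rTensor H (TensorProduct.comm k H H).toLinearMap) ∘ₗ
    (WH.W.comul.rTensor H) ∘ₗ WH.W.comul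

/-- The comultiplication of `H^op ⊗ H` (componentwise, `H^op` carrying the same
coalgebra structure as `H`). -/
noncomputable def comulOpTensor (W : WeakBialgebra k H) :
    (Hᵐᵒᵖ ⊗[k] H) →ₗ[k] (Hᵐᵒᵖ ⊗[k] H) ⊗[k] (Hᵐᵒᵖ ⊗[k] H) :=
  (TensorProduct.tensorTensorTensorComm k Hᵐᵒᵖ Hᵐᵒᵖ H H).toLinearMap ∘ₗ
    (TensorProduct.map
      ((TensorProduct.map (MulOpposite.opLinearEquiv k).toLinearMap
          (MulOpposite.opLinearEquiv k).toLinearMap) ∘ₗ W.comul ∘ₗ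
        (MulOpposite.opLinearEquiv k).symm.toLinearMap)
      W.comul)

/-- The counit of `H^op ⊗ H`. -/
noncomputable def counitOpTensor (W : WeakBialgebra k H) : (Hᵐᵒᵖ ⊗[k] H) →ₗ[k] k :=
  (LinearMap.mul' k k) ∘ₗ
    (TensorProduct.map (W.counit ∘ₗ (MulOpposite.opLinearEquiv k).symm.toLinearMap) W.counit)

end ComoduleAlgebra


theorem exists_sum_tmul {k M N : Type*} [CommRing k] [AddCommGroup M] [Module k M]
    [AddCommGroup N] [Module k N] (z : M ⊗[k] N) :
    ∃ (n : ℕ) (a : Fin n → M) (b : Fin n → N), z = ∑ i, a i ⊗ₜ[k] b i := by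
  induction z with
  | zero => exact ⟨0, Fin.elim0, Fin.elim0, by simp⟩
  | tmul m n => exact ⟨1, fun _ => m, fun _ => n, by simp⟩
  | add z w hz hw =>
    obtain ⟨n, a, b, rfl⟩ := hz
    obtain ⟨m, c, d, rfl⟩ := hw
    exact ⟨n + m, Fin.append a c, Fin.append b d, by simp [Fin.sum_univ_add]⟩

namespace WeakBialgebra

variable {k H : Type*} [CommRing k] [Ring H] [Algebra k H] (W : WeakBialgebra k H)

theorem sum_counit_smul_right {ι : Type*} [Fintype ι] {h : H} {a b : ι → H}
    (hh : W.comul h = ∑ i, a i ⊗ₜ[k] b i) : ∑ i, W.counit (a i) • b i = h := by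
  simpa [hh] using W.counit_left h

theorem sum_counit_smul_left {ι : Type*} [Fintype ι] {h : H} {a b : ι → H}
    (hh : W.comul h = ∑ i, a i ⊗ₜ[k] b i) : ∑ i, W.counit (b i) • a i = h := by
  simpa [hh] using W.counit_right h

theorem comul_mul_comul_one (h : H) : W.comul h * W.comul 1 = W.comul h := by
  rw [← W.comul_mul, mul_one]

theorem comul_one_mul_comul (h : H) : W.comul 1 * W.comul h = W.comul h := by
  rw [← W.comul_mul, one_mul]

section Unit

variable {ι : Type*} [Fintype ι] {x y : ι → H} (hE : W.comul 1 = ∑ i, x i ⊗ₜ[k] y i)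

include hE

theorem sum_tmul_comul_eq_mul_comul_one :
    ∑ i, x i ⊗ₜ[k] W.comul (y i) = ∑ i, x i ⊗ₜ[k] ((y i ⊗ₜ[k] (1 : H)) * W.comul 1) := by
  have h := W.weak_unit_left
  rw [hE] at h
  simp only [hE, Finset.mul_sum, tmul_sum]
  rw [Finset.sum_comm]
  simpa [hE, Finset.sum_mul, Finset.mul_sum, tmul_sum] using h

theorem sum_tmul_comul_eq_comul_one_mul :
    ∑ i, x i ⊗ₜ[k] W.comul (y i) = ∑ i, x i ⊗ₜ[k] (W.comul 1 * (y i ⊗ₜ[k] (1 : H))) := by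
  have h := W.weak_unit_right
  rw [hE] at h
  simpa [hE, Finset.sum_mul, Finset.mul_sum, tmul_sum] using h

theorem sum_comul_tmul_eq_sum_tmul_comul :
    ∑ i, W.comul (x i) ⊗ₜ[k] y i =
      (TensorProduct.assoc k H H H).symm (∑ i, x i ⊗ₜ[k] W.comul (y i)) := by
  have h := W.coassoc 1
  rw [LinearEquiv.eq_symm_apply]
  simpa [hE] using h

theorem sum_comul_tmul_eq_mul_comul_one :
    ∑ i, W.comul (x i) ⊗ₜ[k] y i =
      ∑ i, (((1 : H) ⊗ₜ[k] x i) * W.comul 1) ⊗ₜ[k] y i := by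
  rw [W.sum_comul_tmul_eq_sum_tmul_comul hE, W.sum_tmul_comul_eq_comul_one_mul hE]
  simp only [hE, Finset.sum_mul, Finset.mul_sum, tmul_sum, sum_tmul, map_sum]
  rw [Finset.sum_comm]
  simp

theorem εt_eq_sum (h : H) : W.εt h = ∑ i, W.counit (x i * h) • y i := by
  simp [εt, hE, Finset.sum_mul]

theorem εs_eq_sum (h : H) : W.εs h = ∑ i, W.counit (h * y i) • x i := by
  simp [εs, hE, Finset.mul_sum]

theorem εt'_eq_sum (h : H) : W.εt' h = ∑ i, W.counit (h * x i) • y i := by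
  simp [εt', hE, Finset.mul_sum]

theorem counit_mul_mul_eq_sum (h l : H) :
    W.counit (h * l) = ∑ i, W.counit (h * y i) * W.counit (x i * l) := by
  simpa [hE, Finset.mul_sum, Finset.sum_mul] using W.weak_counit₂ h 1 l

end Unit

theorem comul_εt (h : H) : W.comul (W.εt h) = W.comul 1 * (W.εt h ⊗ₜ[k] (1 : H)) := by
  obtain ⟨n, x, y, hE⟩ := exists_sum_tmul (W.comul 1)
  have := congrArg ((TensorProduct.lid k (H ⊗[k] H)).toLinearMap ∘ₗ
    (W.counit ∘ₗ LinearMap.mulRight k h).rTensor (H ⊗[k] H))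
    (W.sum_tmul_comul_eq_comul_one_mul hE)
  simpa [W.εt_eq_sum hE, sum_tmul, Finset.mul_sum, ← smul_tmul'] using this

theorem comul_εs_mul (h : H) : W.comul (W.εs h) = ((1 : H) ⊗ₜ[k] W.εs h) * W.comul 1 := by
  obtain ⟨n, x, y, hE⟩ := exists_sum_tmul (W.comul 1)
  have := congrArg ((TensorProduct.rid k (H ⊗[k] H)).toLinearMap ∘ₗ
    (W.counit ∘ₗ LinearMap.mulLeft k h).lTensor (H ⊗[k] H))
    (W.sum_comul_tmul_eq_mul_comul_one hE)
  simpa [W.εs_eq_sum hE, tmul_sum, Finset.sum_mul] using this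

theorem εt_mul_εs_comm (g h : H) : W.εt g * W.εs h = W.εs h * W.εt g := by
  obtain ⟨n, x, y, hE⟩ := exists_sum_tmul (W.comul 1)
  have := congrArg ((TensorProduct.lid k H).toLinearMap ∘ₗ
    TensorProduct.map (W.counit ∘ₗ LinearMap.mulRight k g)
      ((TensorProduct.rid k H).toLinearMap ∘ₗ (W.counit ∘ₗ LinearMap.mulLeft k h).lTensor H))
    ((W.sum_tmul_comul_eq_mul_comul_one hE).symm.trans (W.sum_tmul_comul_eq_comul_one_mul hE))
  simp only [hE] at this
  simp only [W.εs_eq_sum hE, W.εt_eq_sum hE, Finset.sum_mul, Finset.mul_sum, smul_mul_assoc,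
    mul_smul_comm, Finset.smul_sum]
  rw [Finset.sum_comm]
  simpa [Finset.smul_sum, Finset.mul_sum, Finset.sum_mul, smul_smul, mul_comm] using this

/-- `ε_s(h₍₁₎) ⊗ h₍₂₎ = (1 ⊗ h)Δ(1)`. -/
theorem rTensor_εs_comul (h : H) :
    W.εs.rTensor H (W.comul h) = ((1 : H) ⊗ₜ[k] h) * W.comul 1 := by
  obtain ⟨n, x, y, hE⟩ := exists_sum_tmul (W.comul 1)
  obtain ⟨m, a, b, hh⟩ := exists_sum_tmul (W.comul h)
  have := congrArg (((TensorProduct.lid k H).toLinearMap ∘ₗ W.counit.rTensor H ∘ₗ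
    LinearMap.mulLeft k (W.comul h)).lTensor H) (W.sum_tmul_comul_eq_comul_one_mul hE)
  simp only [map_sum, LinearMap.lTensor_tmul, LinearMap.comp_apply, LinearMap.mulLeft_apply,
    ← W.comul_mul, ← mul_assoc, mul_one, LinearEquiv.coe_coe, W.counit_left] at this
  rw [hE, Finset.mul_sum]
  simp only [Algebra.TensorProduct.tmul_mul_tmul, one_mul, this, hh, map_sum, Finset.sum_mul,
    LinearMap.rTensor_tmul, W.εs_eq_sum hE, sum_tmul, tmul_sum, mul_one, TensorProduct.lid_tmul,
    smul_tmul]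
  exact Finset.sum_comm

/-- `h₍₁₎ ⊗ ε_t(h₍₂₎) = Δ(1)(h ⊗ 1)`. -/
theorem lTensor_εt_comul (h : H) :
    W.εt.lTensor H (W.comul h) = W.comul 1 * (h ⊗ₜ[k] (1 : H)) := by
  obtain ⟨n, x, y, hE⟩ := exists_sum_tmul (W.comul 1)
  obtain ⟨m, a, b, hh⟩ := exists_sum_tmul (W.comul h)
  have := congrArg (((TensorProduct.rid k H).toLinearMap ∘ₗ W.counit.lTensor H ∘ₗ
    LinearMap.mulRight k (W.comul h)).rTensor H) (W.sum_comul_tmul_eq_mul_comul_one hE)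
  simp only [map_sum, LinearMap.rTensor_tmul, LinearMap.comp_apply, LinearMap.mulRight_apply,
    ← W.comul_mul, mul_assoc, one_mul, LinearEquiv.coe_coe, W.counit_right] at this
  rw [hE, Finset.sum_mul]
  simp only [Algebra.TensorProduct.tmul_mul_tmul, mul_one, this, hh, map_sum, Finset.mul_sum,
    LinearMap.lTensor_tmul, W.εt_eq_sum hE, sum_tmul, tmul_sum, one_mul, TensorProduct.rid_tmul,
    smul_tmul]
  exact Finset.sum_comm

/-- `ε_s(h₍₁₎) ⊗ ε_t(h₍₂₎) = ε_s(h₍₂₎) ⊗ ε_t(h₍₁₎)`. -/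
theorem map_εs_εt_comul (h : H) :
    TensorProduct.map W.εs W.εt (W.comul h) =
      TensorProduct.map W.εs W.εt (TensorProduct.comm k H H (W.comul h)) := by
  obtain ⟨n, x, y, hE⟩ := exists_sum_tmul (W.comul 1)
  obtain ⟨m, a, b, hh⟩ := exists_sum_tmul (W.comul h)
  have h₁ : TensorProduct.map W.εs W.εt (W.comul h) = ∑ i, x i ⊗ₜ[k] W.εt (h * y i) := by
    rw [← LinearMap.lTensor_comp_rTensor, LinearMap.comp_apply, W.rTensor_εs_comul, hE]
    simp [Finset.mul_sum]
  have h₂ (i : Fin n) : W.εt (h * y i) =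
      ∑ j, ∑ l, (W.counit (b l * y i) * W.counit (x j * a l)) • y j := by
    simp only [W.εt_eq_sum hE, ← mul_assoc, W.weak_counit₁ _ h]
    simp [hh, Finset.mul_sum, Finset.sum_mul, Finset.sum_smul, mul_comm]
  simp only [h₁, h₂]
  simp only [hh, map_sum, comm_tmul, TensorProduct.map_tmul, W.εs_eq_sum hE, W.εt_eq_sum hE,
    tmul_sum, sum_tmul, tmul_smul, ← smul_tmul']
  simp only [Finset.smul_sum, smul_smul]
  rw [Finset.sum_comm]
  conv_rhs => rw [Finset.sum_comm]
  refine Finset.sum_congr rfl fun j _ => ?_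
  rw [Finset.sum_comm]
  simp only [mul_comm]

theorem counit_mul_εt (h l : H) : W.counit (h * W.εt l) = W.counit (h * l) := by
  obtain ⟨n, x, y, hE⟩ := exists_sum_tmul (W.comul 1)
  simp [W.εt_eq_sum hE, W.counit_mul_mul_eq_sum hE h l, Finset.mul_sum, mul_comm]

theorem counit_εs_mul (h l : H) : W.counit (W.εs h * l) = W.counit (h * l) := by
  obtain ⟨n, x, y, hE⟩ := exists_sum_tmul (W.comul 1)
  simp [W.εs_eq_sum hE, W.counit_mul_mul_eq_sum hE h l, Finset.sum_mul]

theorem counit_εs (h : H) : W.counit (W.εs h) = W.counit h := by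
  simpa using W.counit_εs_mul h 1

theorem εt_mul_εt (h l : H) : W.εt (h * W.εt l) = W.εt (h * l) := by
  obtain ⟨n, x, y, hE⟩ := exists_sum_tmul (W.comul 1)
  simp only [W.εt_eq_sum hE (h * _), ← mul_assoc, W.counit_mul_εt]

theorem εs_εs_mul (h l : H) : W.εs (W.εs h * l) = W.εs (h * l) := by
  obtain ⟨n, x, y, hE⟩ := exists_sum_tmul (W.comul 1)
  simp only [W.εs_eq_sum hE (_ * l), mul_assoc, W.counit_εs_mul]

theorem εt'_εt (h : H) : W.εt' (W.εt h) = W.εt h := by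
  obtain ⟨n, x, y, hE⟩ := exists_sum_tmul (W.comul 1)
  have := congrArg ((TensorProduct.lid k H).toLinearMap ∘ₗ
    TensorProduct.map (W.counit ∘ₗ LinearMap.mulRight k h)
      ((TensorProduct.lid k H).toLinearMap ∘ₗ W.counit.rTensor H))
    (W.sum_tmul_comul_eq_mul_comul_one hE)
  simp only [map_sum, TensorProduct.map_tmul, LinearMap.comp_apply, LinearEquiv.coe_coe,
    W.counit_left] at this
  simp only [hE] at this
  rw [W.εt_eq_sum hE h, map_sum]
  simpa [W.εt'_eq_sum hE, Finset.mul_sum, Finset.smul_sum, smul_smul]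
    using this.symm

theorem lTensor_εt_comul_one : W.εt.lTensor H (W.comul 1) = W.comul 1 := by
  simpa [← Algebra.TensorProduct.one_def] using W.lTensor_εt_comul 1

theorem rTensor_εs_comul_one : W.εs.rTensor H (W.comul 1) = W.comul 1 := by
  simpa [← Algebra.TensorProduct.one_def] using W.rTensor_εs_comul 1

end WeakBialgebra

section Convolution

variable {k C A : Type*} [CommRing k] [AddCommGroup C] [Module k C] [Ring A] [Algebra k A]

/-- The convolution product of linear maps into an algebra, with respect to `δ`. -/
noncomputable def convolution (δ : C →ₗ[k] C ⊗[k] C) (f g : C →ₗ[k] A) : C →ₗ[k] A :=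
  LinearMap.mul' k A ∘ₗ TensorProduct.map f g ∘ₗ δ

theorem convolution_apply (δ : C →ₗ[k] C ⊗[k] C) (f g : C →ₗ[k] A) (c : C) :
    convolution δ f g c = LinearMap.mul' k A (TensorProduct.map f g (δ c)) := rfl

theorem convolution_apply_eq_sum {δ : C →ₗ[k] C ⊗[k] C} {ι : Type*} [Fintype ι] {c : C}
    {a b : ι → C} (hc : δ c = ∑ i, a i ⊗ₜ[k] b i) (f g : C →ₗ[k] A) :
    convolution δ f g c = ∑ i, f (a i) * g (b i) := by
  simp [convolution_apply, hc]

theorem convolution_assoc {δ : C →ₗ[k] C ⊗[k] C}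
    (hδ : ∀ c, TensorProduct.assoc k C C C (δ.rTensor C (δ c)) = δ.lTensor C (δ c))
    (f g h : C →ₗ[k] A) :
    convolution δ (convolution δ f g) h = convolution δ f (convolution δ g h) := by
  ext c
  have h₁ : ∀ z : C ⊗[k] C, LinearMap.mul' k A (TensorProduct.map (convolution δ f g) h z) =
      LinearMap.mul' k A (TensorProduct.map f (LinearMap.mul' k A ∘ₗ TensorProduct.map g h)
        (TensorProduct.assoc k C C C (δ.rTensor C z))) := by
    intro z
    induction z with
    | zero => simp
    | add z w hz hw => simp only [map_add, hz, hw]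
    | tmul a b =>
      obtain ⟨n, x, y, ha⟩ := exists_sum_tmul (δ a)
      simp [convolution_apply, ha, sum_tmul, mul_assoc]
  have h₂ : ∀ z : C ⊗[k] C, LinearMap.mul' k A (TensorProduct.map f (convolution δ g h) z) =
      LinearMap.mul' k A (TensorProduct.map f (LinearMap.mul' k A ∘ₗ TensorProduct.map g h)
        (δ.lTensor C z)) := by
    intro z
    induction z with
    | zero => simp
    | add z w hz hw => simp only [map_add, hz, hw]
    | tmul a b =>
      obtain ⟨n, x, y, hb⟩ := exists_sum_tmul (δ b)
      simp [convolution_apply, hb, tmul_sum]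
  rw [convolution_apply, h₁, hδ, ← h₂, convolution_apply]

/-- Postcomposition with a multiplicative linear map preserves convolution. -/
theorem comp_convolution {B : Type*} [Ring B] [Algebra k B] (δ : C →ₗ[k] C ⊗[k] C)
    {φ : A →ₗ[k] B} (hφ : ∀ a b, φ (a * b) = φ a * φ b) (f g : C →ₗ[k] A) :
    φ ∘ₗ convolution δ f g = convolution δ (φ ∘ₗ f) (φ ∘ₗ g) := by
  ext c
  obtain ⟨n, x, y, hc⟩ := exists_sum_tmul (δ c)
  simp [convolution_apply_eq_sum hc, hφ]

end Convolution

/-- If `p` is a quasi-inverse of `i₁ * i₂`, and `s₁`, `s₂` are quasi-inverses of `i₁`, `i₂` with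
compatible idempotents, then `p = s₂ * s₁`. -/
theorem eq_op_of_quasiInverse {M : Type*} {op : M → M → M}
    (assoc : ∀ a b c, op (op a b) c = op a (op b c)) {p i₁ i₂ s₁ s₂ e₁ e₂ : M}
    (hs₁ : op s₁ i₁ = e₁) (he : op e₁ e₂ = op e₂ e₁)
    (he₁ : op e₁ s₁ = s₁) (he₂ : op s₂ e₂ = s₂)
    (hl : op p (op i₁ i₂) = op s₂ (op e₁ i₂)) (hr : op (op i₁ i₂) p = op (op i₁ e₂) s₁)
    (hp : op p (op (op i₁ i₂) p) = p) : p = op s₂ s₁ := by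
  calc p = op (op p (op i₁ i₂)) p := by rw [assoc, hp]
    _ = op (op s₂ s₁) (op (op i₁ i₂) p) := by
      rw [hl, ← hs₁]; simp only [assoc]
    _ = op s₂ (op (op (op s₁ i₁) e₂) s₁) := by rw [hr]; simp only [assoc]
    _ = op (op s₂ e₂) (op e₁ s₁) := by rw [hs₁, he]; simp only [assoc]
    _ = op s₂ s₁ := by rw [he₁, he₂]

namespace WeakBialgebra

variable {k H : Type*} [CommRing k] [Ring H] [Algebra k H] (W : WeakBialgebra k H)

/-- The coalgebra underlying a weak bialgebra. -/
@[reducible] def toCoalgebra : Coalgebra k H where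
  comul := W.comul
  counit := W.counit
  coassoc := LinearMap.ext W.coassoc
  rTensor_counit_comp_comul := by
    ext h
    apply (TensorProduct.lid k H).injective
    simpa using W.counit_left h
  lTensor_counit_comp_comul := by
    ext h
    apply (TensorProduct.rid k H).injective
    simpa using W.counit_right h

/-- The comultiplication of `H ⊗ H`. -/
noncomputable def comulTensor : H ⊗[k] H →ₗ[k] (H ⊗[k] H) ⊗[k] (H ⊗[k] H) :=
  (TensorProduct.tensorTensorTensorComm k H H H H).toLinearMap ∘ₗ
    TensorProduct.map W.comul W.comul

theorem coassoc_comulTensor (z : H ⊗[k] H) :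
    TensorProduct.assoc k _ _ _ (W.comulTensor.rTensor _ (W.comulTensor z)) =
      W.comulTensor.lTensor _ (W.comulTensor z) := by
  let := W.toCoalgebra
  exact Coalgebra.coassoc_apply (R := k) z

theorem comulTensor_tmul_eq_sum {ι κ : Type*} [Fintype ι] [Fintype κ] {g h : H} {a b : ι → H}
    {c d : κ → H} (hg : W.comul g = ∑ i, a i ⊗ₜ[k] b i) (hh : W.comul h = ∑ i, c i ⊗ₜ[k] d i) :
    W.comulTensor (g ⊗ₜ h) =
      ∑ p : ι × κ, (a p.1 ⊗ₜ[k] c p.2) ⊗ₜ[k] (b p.1 ⊗ₜ[k] d p.2) := by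
  simp [comulTensor, hg, hh, sum_tmul, tmul_sum, Fintype.sum_prod_type]
  exact Finset.sum_comm

section

variable {A : Type*} [Ring A] [Algebra k A]

/-- The map `g ⊗ h ↦ ε(h)f(g)`. -/
noncomputable def onLeft (f : H →ₗ[k] A) : H ⊗[k] H →ₗ[k] A :=
  f ∘ₗ (TensorProduct.rid k H).toLinearMap ∘ₗ W.counit.lTensor H

/-- The map `g ⊗ h ↦ ε(g)f(h)`. -/
noncomputable def onRight (f : H →ₗ[k] A) : H ⊗[k] H →ₗ[k] A :=
  f ∘ₗ (TensorProduct.lid k H).toLinearMap ∘ₗ W.counit.rTensor H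

@[simp] theorem onLeft_tmul (f : H →ₗ[k] A) (g h : H) :
    W.onLeft f (g ⊗ₜ h) = W.counit h • f g := by simp [onLeft]

@[simp] theorem onRight_tmul (f : H →ₗ[k] A) (g h : H) :
    W.onRight f (g ⊗ₜ h) = W.counit g • f h := by simp [onRight]

theorem convolution_onLeft_left (f : H →ₗ[k] A) (F : H ⊗[k] H →ₗ[k] A) {ι : Type*} [Fintype ι]
    {g : H} {a b : ι → H} (hg : W.comul g = ∑ i, a i ⊗ₜ[k] b i) (h : H) :
    convolution W.comulTensor (W.onLeft f) F (g ⊗ₜ h) = ∑ i, f (a i) * F (b i ⊗ₜ h) := by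
  obtain ⟨m, c, d, hh⟩ := exists_sum_tmul (W.comul h)
  rw [convolution_apply_eq_sum (W.comulTensor_tmul_eq_sum hg hh)]
  conv_rhs => rw [← W.sum_counit_smul_right hh]
  simp [Fintype.sum_prod_type, tmul_sum, Finset.mul_sum]

theorem convolution_onRight_left (f : H →ₗ[k] A) (F : H ⊗[k] H →ₗ[k] A) {ι : Type*} [Fintype ι]
    {h : H} {a b : ι → H} (hh : W.comul h = ∑ i, a i ⊗ₜ[k] b i) (g : H) :
    convolution W.comulTensor (W.onRight f) F (g ⊗ₜ h) = ∑ i, f (a i) * F (g ⊗ₜ b i) := by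
  obtain ⟨m, c, d, hg⟩ := exists_sum_tmul (W.comul g)
  rw [convolution_apply_eq_sum (W.comulTensor_tmul_eq_sum hg hh)]
  conv_rhs => rw [← W.sum_counit_smul_right hg]
  simp only [Fintype.sum_prod_type, sum_tmul, map_sum, Finset.mul_sum]
  rw [Finset.sum_comm]
  simp [← smul_tmul']

theorem convolution_onLeft_right (F : H ⊗[k] H →ₗ[k] A) (f : H →ₗ[k] A) {ι : Type*} [Fintype ι]
    {g : H} {a b : ι → H} (hg : W.comul g = ∑ i, a i ⊗ₜ[k] b i) (h : H) :
    convolution W.comulTensor F (W.onLeft f) (g ⊗ₜ h) = ∑ i, F (a i ⊗ₜ h) * f (b i) := by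
  obtain ⟨m, c, d, hh⟩ := exists_sum_tmul (W.comul h)
  rw [convolution_apply_eq_sum (W.comulTensor_tmul_eq_sum hg hh)]
  conv_rhs => rw [← W.sum_counit_smul_left hh]
  simp [Fintype.sum_prod_type, tmul_sum, Finset.sum_mul]

theorem convolution_onLeft_onLeft (f g : H →ₗ[k] A) :
    convolution W.comulTensor (W.onLeft f) (W.onLeft g) =
      W.onLeft (convolution W.comul f g) := by
  ext a b
  obtain ⟨n, x, y, ha⟩ := exists_sum_tmul (W.comul a)
  simp [W.convolution_onLeft_left _ _ ha, convolution_apply_eq_sum ha, Finset.smul_sum]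

theorem convolution_onRight_onRight (f g : H →ₗ[k] A) :
    convolution W.comulTensor (W.onRight f) (W.onRight g) =
      W.onRight (convolution W.comul f g) := by
  ext a b
  obtain ⟨n, x, y, hb⟩ := exists_sum_tmul (W.comul b)
  simp [W.convolution_onRight_left _ _ hb, convolution_apply_eq_sum hb, Finset.smul_sum]

theorem convolution_onLeft_onRight_tmul (f g : H →ₗ[k] A) (a b : H) :
    convolution W.comulTensor (W.onLeft f) (W.onRight g) (a ⊗ₜ b) = f a * g b := by
  obtain ⟨n, x, y, ha⟩ := exists_sum_tmul (W.comul a)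
  rw [W.convolution_onLeft_left _ _ ha]
  conv_rhs => rw [← W.sum_counit_smul_left ha]
  simp [Finset.sum_mul]

theorem convolution_onRight_onLeft_tmul (f g : H →ₗ[k] A) (a b : H) :
    convolution W.comulTensor (W.onRight f) (W.onLeft g) (a ⊗ₜ b) = f b * g a := by
  obtain ⟨n, x, y, hb⟩ := exists_sum_tmul (W.comul b)
  rw [W.convolution_onRight_left _ _ hb]
  conv_rhs => rw [← W.sum_counit_smul_left hb]
  simp [Finset.sum_mul]

theorem convolution_comp_mul' (f g : H →ₗ[k] A) :
    convolution W.comulTensor (f ∘ₗ LinearMap.mul' k H) (g ∘ₗ LinearMap.mul' k H) =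
      convolution W.comul f g ∘ₗ LinearMap.mul' k H := by
  ext a b
  obtain ⟨n, x, y, ha⟩ := exists_sum_tmul (W.comul a)
  obtain ⟨m, c, d, hb⟩ := exists_sum_tmul (W.comul b)
  have hab : W.comul (a * b) =
      ∑ p : Fin n × Fin m, (x p.1 * c p.2) ⊗ₜ[k] (y p.1 * d p.2) := by
    rw [W.comul_mul, ha, hb, Fintype.sum_prod_type]
    simp only [Finset.sum_mul_sum, Algebra.TensorProduct.tmul_mul_tmul]
  simp [convolution_apply_eq_sum (W.comulTensor_tmul_eq_sum ha hb), convolution_apply_eq_sum hab]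

end

end WeakBialgebra

namespace WeakHopf

variable {k H : Type*} [CommRing k] [Ring H] [Algebra k H] (WH : WeakHopf k H)

theorem convolution_S_id : convolution WH.W.comul WH.S LinearMap.id = WH.W.εs :=
  LinearMap.ext WH.S_conv_id

theorem convolution_id_S : convolution WH.W.comul LinearMap.id WH.S = WH.W.εt :=
  LinearMap.ext WH.id_conv_S

theorem convolution_assoc' {A : Type*} [Ring A] [Algebra k A] (f g h : H →ₗ[k] A) :
    convolution WH.W.comul (convolution WH.W.comul f g) h =
      convolution WH.W.comul f (convolution WH.W.comul g h) :=
  convolution_assoc WH.W.coassoc f g h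

theorem convolution_S_εt : convolution WH.W.comul WH.S WH.W.εt = WH.S := by
  rw [← convolution_id_S]
  ext h
  rw [← WH.S_conv_id_conv_S h, convolution_apply, convolution]
  obtain ⟨n, a, b, hh⟩ := exists_sum_tmul (WH.W.comul h)
  simp [hh, LinearMap.lTensor]

theorem convolution_εs_S : convolution WH.W.comul WH.W.εs WH.S = WH.S := by
  rw [← convolution_S_id, convolution_assoc', convolution_id_S, convolution_S_εt]

theorem S_mul (g h : H) : WH.S (g * h) = WH.S h * WH.S g := by
  have key := eq_op_of_quasiInverse (op := convolution WH.W.comulTensor)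
    (convolution_assoc WH.W.coassoc_comulTensor)
    (p := WH.S ∘ₗ LinearMap.mul' k H) (i₁ := WH.W.onLeft LinearMap.id)
    (i₂ := WH.W.onRight LinearMap.id) (s₁ := WH.W.onLeft WH.S) (s₂ := WH.W.onRight WH.S)
    (e₁ := WH.W.onLeft WH.W.εs) (e₂ := WH.W.onRight WH.W.εt)
  have hμ : convolution WH.W.comulTensor (WH.W.onLeft LinearMap.id)
      (WH.W.onRight LinearMap.id) = LinearMap.id ∘ₗ LinearMap.mul' k H := by
    ext a b
    simp [WH.W.convolution_onLeft_onRight_tmul]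
  rw [hμ] at key
  have := LinearMap.congr_fun (key ?_ ?_ ?_ ?_ ?_ ?_ ?_) (g ⊗ₜ h)
  · simpa [WH.W.convolution_onRight_onLeft_tmul] using this
  · rw [WH.W.convolution_onLeft_onLeft, convolution_S_id]
  · ext a b
    simp [WH.W.convolution_onLeft_onRight_tmul, WH.W.convolution_onRight_onLeft_tmul,
      WH.W.εt_mul_εs_comm]
  · rw [WH.W.convolution_onLeft_onLeft, convolution_εs_S]
  · rw [WH.W.convolution_onRight_onRight, convolution_S_εt]
  · rw [WH.W.convolution_comp_mul', convolution_S_id]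
    ext a b
    obtain ⟨n, x, y, hb⟩ := exists_sum_tmul (WH.W.comul b)
    have hab : WH.W.comul (WH.W.εs a * b) = ∑ i, x i ⊗ₜ[k] (WH.W.εs a * y i) := by
      rw [WH.W.comul_mul, WH.W.comul_εs_mul, mul_assoc, WH.W.comul_one_mul_comul, hb]
      simp [Finset.mul_sum]
    have := LinearMap.congr_fun WH.convolution_S_id (WH.W.εs a * b)
    rw [convolution_apply_eq_sum hab, WH.W.εs_εs_mul] at this
    simp [WH.W.convolution_onRight_left _ _ hb, WH.W.convolution_onLeft_onRight_tmul, ← this]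
  · rw [WH.W.convolution_comp_mul', convolution_id_S]
    ext a b
    obtain ⟨n, x, y, ha⟩ := exists_sum_tmul (WH.W.comul a)
    have hab : WH.W.comul (a * WH.W.εt b) = ∑ i, (x i * WH.W.εt b) ⊗ₜ[k] y i := by
      rw [WH.W.comul_mul, WH.W.comul_εt, ← mul_assoc, WH.W.comul_mul_comul_one, ha]
      simp [Finset.sum_mul]
    have := LinearMap.congr_fun WH.convolution_id_S (a * WH.W.εt b)
    rw [convolution_apply_eq_sum hab, WH.W.εt_mul_εt] at this
    simp [WH.W.convolution_onLeft_right _ _ ha, WH.W.convolution_onLeft_onRight_tmul, ← this]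
  · simp only [WH.W.convolution_comp_mul', convolution_id_S, convolution_S_εt]

theorem comul_S (h : H) :
    WH.W.comul (WH.S h) = TensorProduct.map WH.S WH.S (TensorProduct.comm k H H (WH.W.comul h)) := by
  let j₁ := (Algebra.TensorProduct.includeLeft : H →ₐ[k] H ⊗[k] H)
  let j₂ := (Algebra.TensorProduct.includeRight : H →ₐ[k] H ⊗[k] H)
  have key := eq_op_of_quasiInverse (op := convolution (A := H ⊗[k] H) WH.W.comul)
    (convolution_assoc WH.W.coassoc)
    (p := WH.W.comul ∘ₗ WH.S) (i₁ := j₁.toLinearMap)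
    (i₂ := j₂.toLinearMap) (s₁ := j₁.toLinearMap ∘ₗ WH.S) (s₂ := j₂.toLinearMap ∘ₗ WH.S)
    (e₁ := j₁.toLinearMap ∘ₗ WH.W.εs) (e₂ := j₂.toLinearMap ∘ₗ WH.W.εt)
  have c₁ (f g : H →ₗ[k] H) := comp_convolution WH.W.comul (φ := j₁.toLinearMap) (map_mul j₁) f g
  have c₂ (f g : H →ₗ[k] H) := comp_convolution WH.W.comul (φ := j₂.toLinearMap) (map_mul j₂) f g
  have c₁₂ (f g : H →ₗ[k] H) (a : H) : convolution WH.W.comul (j₁.toLinearMap ∘ₗ f)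
      (j₂.toLinearMap ∘ₗ g) a = TensorProduct.map f g (WH.W.comul a) := by
    obtain ⟨n, x, y, ha⟩ := exists_sum_tmul (WH.W.comul a)
    simp [j₁, j₂, convolution_apply_eq_sum ha, ha]
  have c₂₁ (f g : H →ₗ[k] H) (a : H) : convolution WH.W.comul (j₂.toLinearMap ∘ₗ f)
      (j₁.toLinearMap ∘ₗ g) a = TensorProduct.map g f (TensorProduct.comm k H H (WH.W.comul a)) := by
    obtain ⟨n, x, y, ha⟩ := exists_sum_tmul (WH.W.comul a)
    simp [j₁, j₂, convolution_apply_eq_sum ha, ha]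
  have hΔ : convolution WH.W.comul j₁.toLinearMap j₂.toLinearMap =
      WH.W.comul ∘ₗ LinearMap.id := by
    ext a
    simpa using c₁₂ LinearMap.id LinearMap.id a
  rw [hΔ] at key
  have := LinearMap.congr_fun (key ?_ ?_ ?_ ?_ ?_ ?_ ?_) h
  · rwa [c₂₁] at this
  · rw [← convolution_S_id, c₁]; rfl
  · ext a
    rw [c₁₂, c₂₁, WH.W.map_εs_εt_comul]
  · rw [← c₁, convolution_εs_S]
  · rw [← c₂, convolution_S_εt]
  · rw [← comp_convolution _ WH.W.comul_mul, convolution_S_id]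
    have : convolution WH.W.comul (j₁.toLinearMap ∘ₗ WH.W.εs) j₂.toLinearMap =
        LinearMap.mulRight k (WH.W.comul 1) ∘ₗ j₂.toLinearMap := by
      ext a
      refine (c₁₂ WH.W.εs LinearMap.id a).trans ?_
      exact WH.W.rTensor_εs_comul a
    rw [this]
    ext a
    obtain ⟨n, x, y, ha⟩ := exists_sum_tmul (WH.W.comul a)
    have h₂ := LinearMap.congr_fun WH.convolution_S_id a
    rw [convolution_apply_eq_sum ha] at h₂
    rw [LinearMap.comp_apply, WH.W.comul_εs_mul, ← h₂, convolution_apply_eq_sum ha]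
    simp [j₂, tmul_sum, Finset.sum_mul, ← mul_assoc]
  · rw [← comp_convolution _ WH.W.comul_mul, convolution_id_S]
    have : convolution WH.W.comul j₁.toLinearMap (j₂.toLinearMap ∘ₗ WH.W.εt) =
        LinearMap.mulLeft k (WH.W.comul 1) ∘ₗ j₁.toLinearMap := by
      ext a
      refine (c₁₂ LinearMap.id WH.W.εt a).trans ?_
      exact WH.W.lTensor_εt_comul a
    rw [this]
    ext a
    obtain ⟨n, x, y, ha⟩ := exists_sum_tmul (WH.W.comul a)
    have h₂ := LinearMap.congr_fun WH.convolution_id_S a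
    rw [convolution_apply_eq_sum ha] at h₂
    rw [LinearMap.comp_apply, WH.W.comul_εt, ← h₂, convolution_apply_eq_sum ha]
    simp [j₁, sum_tmul, Finset.mul_sum, mul_assoc]
  · simp only [← comp_convolution _ WH.W.comul_mul, convolution_id_S, convolution_S_εt]

theorem counit_S (h : H) : WH.W.counit (WH.S h) = WH.W.counit h := by
  obtain ⟨n, x, y, hh⟩ := exists_sum_tmul (WH.W.comul h)
  have h₁ := LinearMap.congr_fun WH.convolution_S_εt h
  have h₂ := LinearMap.congr_fun WH.convolution_S_id h
  rw [convolution_apply_eq_sum hh] at h₁ h₂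
  rw [← WH.W.counit_εs h, ← h₁, ← h₂]
  simp [WH.W.counit_mul_εt]

theorem S_εt (h : H) : WH.S (WH.W.εt h) = WH.W.εs (WH.S h) := by
  obtain ⟨n, x, y, hh⟩ := exists_sum_tmul (WH.W.comul h)
  have h₁ := LinearMap.congr_fun WH.convolution_id_S h
  rw [convolution_apply_eq_sum hh] at h₁
  rw [← h₁, ← WH.S_conv_id, WH.comul_S, hh]
  simp [WH.S_mul]

section Inverse

variable {Sinv : H →ₗ[k] H} (h₁ : ∀ h, Sinv (WH.S h) = h) (h₂ : ∀ h, WH.S (Sinv h) = h)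

include h₁ h₂

theorem Sinv_mul (g h : H) : Sinv (g * h) = Sinv h * Sinv g := by
  rw [← h₁ (Sinv h * Sinv g), WH.S_mul, h₂, h₂]

theorem comul_Sinv (h : H) : WH.W.comul (Sinv h) =
    TensorProduct.map Sinv Sinv (TensorProduct.comm k H H (WH.W.comul h)) := by
  have := WH.comul_S (Sinv h)
  rw [h₂] at this
  obtain ⟨n, x, y, hh⟩ := exists_sum_tmul (WH.W.comul (Sinv h))
  simp [this, hh, h₁]

theorem εt'_Sinv_εs (h : H) : WH.W.εt' (Sinv (WH.W.εs h)) = Sinv (WH.W.εs h) := by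
  rw [← h₂ h, ← WH.S_εt, h₁, WH.W.εt'_εt]

end Inverse

theorem counit_Sinv {Sinv : H →ₗ[k] H} (h₂ : ∀ h, WH.S (Sinv h) = h) (h : H) :
    WH.W.counit (Sinv h) = WH.W.counit h := by
  rw [← WH.counit_S, h₂]

end WeakHopf

section Coaction

variable {k H : Type*} [CommRing k] [Ring H] [Algebra k H]

theorem mul_of_forall_tmul_mul {M N A : Type*} [Ring M] [Algebra k M] [Ring N] [Algebra k N]
    [NonUnitalNonAssocSemiring A] [Module k A] {φ : M ⊗[k] N →ₗ[k] A}
    (hφ : ∀ a a' b b', φ ((a * a') ⊗ₜ (b * b')) = φ (a ⊗ₜ b) * φ (a' ⊗ₜ b'))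
    (z w : M ⊗[k] N) : φ (z * w) = φ z * φ w := by
  obtain ⟨n, a, b, rfl⟩ := exists_sum_tmul z
  obtain ⟨m, c, d, rfl⟩ := exists_sum_tmul w
  simp [Finset.sum_mul_sum, hφ]

namespace WeakBialgebra

variable (W : WeakBialgebra k H)

/-- The iterated comultiplication `h ↦ (h₍₁₎ ⊗ h₍₂₎) ⊗ h₍₃₎`. -/
noncomputable def comul₃ : H →ₗ[k] (H ⊗[k] H) ⊗[k] H := W.comul.rTensor H ∘ₗ W.comul

theorem comul₃_mul (g h : H) : W.comul₃ (g * h) = W.comul₃ g * W.comul₃ h := by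
  rw [comul₃, LinearMap.comp_apply, W.comul_mul]
  exact mul_of_forall_tmul_mul (φ := W.comul.rTensor H) (by simp [W.comul_mul]) _ _

theorem εt_εt (h : H) : W.εt (W.εt h) = W.εt h := by
  simpa using W.εt_mul_εt 1 h

theorem map_εs_εt_comul₃_one :
    TensorProduct.map (W.εs.rTensor H) W.εt (W.comul₃ 1) = W.comul₃ 1 := by
  have h₁ : W.εt.lTensor (H ⊗[k] H) (W.comul₃ 1) = W.comul₃ 1 := by
    rw [comul₃, LinearMap.comp_apply, ← LinearMap.comp_apply, LinearMap.lTensor_comp_rTensor,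
      ← LinearMap.rTensor_comp_lTensor, LinearMap.comp_apply, W.lTensor_εt_comul_one]
  have h₂ : (W.εs.rTensor H).rTensor H (W.comul₃ 1) = W.comul₃ 1 := by
    have hc : W.comul₃ 1 = (TensorProduct.assoc k H H H).symm (W.comul.lTensor H (W.comul 1)) :=
      (LinearEquiv.eq_symm_apply _).2 (W.coassoc 1)
    have hr (z : H ⊗[k] (H ⊗[k] H)) : (W.εs.rTensor H).rTensor H
        ((TensorProduct.assoc k H H H).symm z) =
        (TensorProduct.assoc k H H H).symm (W.εs.rTensor (H ⊗[k] H) z) := by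
      rw [LinearEquiv.eq_symm_apply]
      simp [LinearMap.rTensor_tensor]
    rw [hc, hr, ← LinearMap.comp_apply, LinearMap.rTensor_comp_lTensor,
      ← LinearMap.lTensor_comp_rTensor, LinearMap.comp_apply, W.rTensor_εs_comul_one]
  rw [← LinearMap.rTensor_comp_lTensor, LinearMap.comp_apply, h₁, h₂]

theorem apply_comul₃_eq_convolution {A : Type*} [Ring A] [Algebra k A]
    {Φ : (H ⊗[k] H) ⊗[k] H →ₗ[k] A} {f g l : H →ₗ[k] A}
    (hΦ : ∀ a b c, Φ ((a ⊗ₜ b) ⊗ₜ c) = f a * g b * l c) :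
    Φ ∘ₗ W.comul₃ = convolution W.comul (convolution W.comul f g) l := by
  ext h
  obtain ⟨n, x, y, hh⟩ := exists_sum_tmul (W.comul h)
  rw [convolution_apply_eq_sum hh, comul₃, LinearMap.comp_apply, LinearMap.comp_apply, hh]
  simp only [map_sum, LinearMap.rTensor_tmul]
  refine Finset.sum_congr rfl fun i _ => ?_
  obtain ⟨m, a, b, hx⟩ := exists_sum_tmul (W.comul (x i))
  simp [convolution_apply_eq_sum hx, hx, sum_tmul, hΦ, Finset.sum_mul]

end WeakBialgebra

/-- The map `(a ⊗ b) ⊗ c ↦ b ⊗ (T(a) ⊗ c)` into `H ⊗ (H^op ⊗ H)`. -/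
noncomputable def twist (T : H →ₗ[k] H) : (H ⊗[k] H) ⊗[k] H →ₗ[k] H ⊗[k] (Hᵐᵒᵖ ⊗[k] H) :=
  (LinearMap.lTensor H
      (TensorProduct.map ((MulOpposite.opLinearEquiv k).toLinearMap ∘ₗ T) LinearMap.id)) ∘ₗ
    (TensorProduct.assoc k H H H).toLinearMap ∘ₗ
    (LinearMap.rTensor H (TensorProduct.comm k H H).toLinearMap)

@[simp] theorem twist_tmul (T : H →ₗ[k] H) (a b c : H) :
    twist T ((a ⊗ₜ b) ⊗ₜ c) = b ⊗ₜ[k] (MulOpposite.op (T a) ⊗ₜ[k] c) := rfl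

theorem twist_mul {T : H →ₗ[k] H} (hT : ∀ a b, T (a * b) = T b * T a)
    (z w : (H ⊗[k] H) ⊗[k] H) : twist T (z * w) = twist T z * twist T w := by
  have key {B : Type _} [Ring B] [Algebra k B] (τ : H →ₗ[k] B)
      (hτ : ∀ a b, τ (a * b) = τ a * τ b) (φ : (H ⊗[k] H) ⊗[k] H →ₗ[k] H ⊗[k] (B ⊗[k] H))
      (hφ : ∀ a b c, φ ((a ⊗ₜ b) ⊗ₜ c) = b ⊗ₜ (τ a ⊗ₜ c)) : φ (z * w) = φ z * φ w := by
    refine mul_of_forall_tmul_mul (φ := φ) (fun a a' b b' => ?_) z w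
    obtain ⟨n, x, y, rfl⟩ := exists_sum_tmul a
    obtain ⟨m, c, d, rfl⟩ := exists_sum_tmul a'
    simp [Finset.sum_mul_sum, sum_tmul, hτ, hφ]
  exact key ((MulOpposite.opLinearEquiv k).toLinearMap ∘ₗ T) (by simp [hT]) (twist T)
    (twist_tmul T)

theorem weakHopfDoubleCoaction_eq (WH : WeakHopf k H) (T : H →ₗ[k] H) :
    weakHopfDoubleCoaction WH T = twist T ∘ₗ WH.W.comul₃ := rfl

/-- The algebra `H^op ⊗ H`. -/
abbrev OpTensor (k H : Type*) [CommRing k] [Ring H] [Algebra k H] := Hᵐᵒᵖ ⊗[k] H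

set_option maxSynthPendingDepth 6 in
/-- If `T` is anticomultiplicative, then `h ↦ h₍₂₎ ⊗ (T(h₍₁₎) ⊗ h₍₃₎)` is coassociative. -/
theorem weakHopfDoubleCoaction_coassoc (WH : WeakHopf k H) {T : H →ₗ[k] H}
    (hT : ∀ h, WH.W.comul (T h) =
      TensorProduct.map T T (TensorProduct.comm k H H (WH.W.comul h))) :
    (TensorProduct.assoc k H (Hᵐᵒᵖ ⊗[k] H) (Hᵐᵒᵖ ⊗[k] H)).toLinearMap ∘ₗ
        (weakHopfDoubleCoaction WH T).rTensor (Hᵐᵒᵖ ⊗[k] H) ∘ₗ weakHopfDoubleCoaction WH T =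
      (comulOpTensor WH.W).lTensor H ∘ₗ weakHopfDoubleCoaction WH T := by
  let r : OpTensor k H ⊗[k] OpTensor k H →ₐ[k] H ⊗[k] (OpTensor k H ⊗[k] OpTensor k H) :=
    Algebra.TensorProduct.includeRight
  let p : OpTensor k H →ₐ[k] H ⊗[k] (OpTensor k H ⊗[k] OpTensor k H) :=
    r.comp Algebra.TensorProduct.includeLeft
  let q : OpTensor k H →ₐ[k] H ⊗[k] (OpTensor k H ⊗[k] OpTensor k H) :=
    r.comp Algebra.TensorProduct.includeRight
  let t : H →ₗ[k] OpTensor k H :=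
    (Algebra.TensorProduct.includeLeft : Hᵐᵒᵖ →ₐ[k] OpTensor k H).toLinearMap ∘ₗ
      (MulOpposite.opLinearEquiv k).toLinearMap ∘ₗ T
  let u : H →ₗ[k] OpTensor k H :=
    (Algebra.TensorProduct.includeRight : H →ₐ[k] OpTensor k H).toLinearMap
  let m : H →ₗ[k] H ⊗[k] (OpTensor k H ⊗[k] OpTensor k H) :=
    (Algebra.TensorProduct.includeLeft :
      H →ₐ[k] H ⊗[k] (OpTensor k H ⊗[k] OpTensor k H)).toLinearMap
  let pt : H →ₗ[k] H ⊗[k] (OpTensor k H ⊗[k] OpTensor k H) := p.toLinearMap ∘ₗ t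
  let qt : H →ₗ[k] H ⊗[k] (OpTensor k H ⊗[k] OpTensor k H) := q.toLinearMap ∘ₗ t
  let pu : H →ₗ[k] H ⊗[k] (OpTensor k H ⊗[k] OpTensor k H) := p.toLinearMap ∘ₗ u
  let qu : H →ₗ[k] H ⊗[k] (OpTensor k H ⊗[k] OpTensor k H) := q.toLinearMap ∘ₗ u
  let inc : H ⊗[k] OpTensor k H →ₗ[k] H ⊗[k] (OpTensor k H ⊗[k] OpTensor k H) :=
    (Algebra.TensorProduct.includeLeft :
      OpTensor k H →ₐ[k] OpTensor k H ⊗[k] OpTensor k H).toLinearMap.lTensor H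
  have hρ : inc ∘ₗ weakHopfDoubleCoaction WH T =
      convolution WH.W.comul (convolution WH.W.comul pt m) pu := by
    rw [weakHopfDoubleCoaction_eq, ← LinearMap.comp_assoc]
    refine WH.W.apply_comul₃_eq_convolution fun a b c => ?_
    simp [inc, pt, m, pu, p, t, u, r]
  have hl : (TensorProduct.assoc k H (OpTensor k H) (OpTensor k H)).toLinearMap ∘ₗ
      (weakHopfDoubleCoaction WH T).rTensor (OpTensor k H) ∘ₗ weakHopfDoubleCoaction WH T =
      convolution WH.W.comul (convolution WH.W.comul qt (inc ∘ₗ weakHopfDoubleCoaction WH T))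
        qu := by
    conv_lhs => enter [2, 2]; rw [weakHopfDoubleCoaction_eq]
    rw [← LinearMap.comp_assoc, ← LinearMap.comp_assoc]
    refine WH.W.apply_comul₃_eq_convolution fun a b c => ?_
    obtain ⟨n, x, y, hb⟩ := exists_sum_tmul (weakHopfDoubleCoaction WH T b)
    simp [inc, qt, qu, q, t, u, r, hb, sum_tmul, Finset.mul_sum, Finset.sum_mul]
  have hr : (comulOpTensor WH.W).lTensor H ∘ₗ weakHopfDoubleCoaction WH T =
      convolution WH.W.comul (convolution WH.W.comul (convolution WH.W.comul qt pt) m)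
        (convolution WH.W.comul pu qu) := by
    rw [weakHopfDoubleCoaction_eq, ← LinearMap.comp_assoc]
    refine WH.W.apply_comul₃_eq_convolution fun a b c => ?_
    obtain ⟨n, x, y, ha⟩ := exists_sum_tmul (WH.W.comul a)
    obtain ⟨n', x', y', hc⟩ := exists_sum_tmul (WH.W.comul c)
    simp [comulOpTensor, hT, ha, hc, convolution_apply_eq_sum ha, convolution_apply_eq_sum hc,
      pt, qt, pu, qu, m, p, q, t, u, r, sum_tmul, tmul_sum, Finset.mul_sum, Finset.sum_mul]
  rw [hl, hr, hρ]
  simp only [convolution_assoc WH.W.coassoc]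

theorem weakHopfDoubleCoaction_counital (WH : WeakHopf k H) {T : H →ₗ[k] H}
    (hT : ∀ h, WH.W.counit (T h) = WH.W.counit h) (h : H) :
    TensorProduct.rid k H ((counitOpTensor WH.W).lTensor H (weakHopfDoubleCoaction WH T h)) =
      h := by
  have hΦ : (TensorProduct.rid k H).toLinearMap ∘ₗ (counitOpTensor WH.W).lTensor H ∘ₗ twist T =
      (TensorProduct.rid k H).toLinearMap ∘ₗ TensorProduct.map
        ((TensorProduct.lid k H).toLinearMap ∘ₗ WH.W.counit.rTensor H) WH.W.counit := by
    ext a b c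
    simp [counitOpTensor, hT, smul_smul, mul_comm]
  refine (LinearMap.congr_fun hΦ (WH.W.comul₃ h)).trans ?_
  have hid : ((TensorProduct.lid k H).toLinearMap ∘ₗ WH.W.counit.rTensor H) ∘ₗ WH.W.comul =
      LinearMap.id := LinearMap.ext WH.W.counit_left
  rw [WeakBialgebra.comul₃, LinearMap.comp_apply, LinearMap.comp_apply,
    ← LinearMap.comp_apply (TensorProduct.map _ _), LinearMap.map_comp_rTensor, hid]
  exact WH.W.counit_right h

theorem weakHopfDoubleCoaction_mul (WH : WeakHopf k H) {T : H →ₗ[k] H}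
    (hT : ∀ a b, T (a * b) = T b * T a) (g h : H) :
    weakHopfDoubleCoaction WH T (g * h) =
      weakHopfDoubleCoaction WH T g * weakHopfDoubleCoaction WH T h := by
  simp only [weakHopfDoubleCoaction_eq, LinearMap.comp_apply, WH.W.comul₃_mul, twist_mul hT]

theorem weakHopfDoubleCoaction_one (WH : WeakHopf k H) {T : H →ₗ[k] H}
    (hT : ∀ h, WH.W.εt' (T (WH.W.εs h)) = T (WH.W.εs h)) :
    weakHopfDoubleCoaction WH T 1 =
      (LinearMap.lTensor H (TensorProduct.map
        ((MulOpposite.opLinearEquiv k).toLinearMap ∘ₗ WH.W.εt' ∘ₗ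
          (MulOpposite.opLinearEquiv k).symm.toLinearMap) WH.W.εt))
        (weakHopfDoubleCoaction WH T 1) := by
  have h : twist T ∘ₗ TensorProduct.map (WH.W.εs.rTensor H) WH.W.εt =
      LinearMap.lTensor H (TensorProduct.map
        ((MulOpposite.opLinearEquiv k).toLinearMap ∘ₗ WH.W.εt' ∘ₗ
          (MulOpposite.opLinearEquiv k).symm.toLinearMap) WH.W.εt) ∘ₗ
        twist T ∘ₗ TensorProduct.map (WH.W.εs.rTensor H) WH.W.εt := by
    ext a b c
    simp [hT, WH.W.εt_εt]
  have := LinearMap.congr_fun h (WH.W.comul₃ 1)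
  simpa only [weakHopfDoubleCoaction_eq, LinearMap.comp_apply, WH.W.map_εs_εt_comul₃_one] using this

end Coaction

/-- `H` is a right `H^op ⊗ H`-comodule algebra via
`ρ(h) = h₍₂₎ ⊗ (S⁻¹(h₍₁₎) ⊗ h₍₃₎)`: the coaction is coassociative and counital,
multiplicative, and `ρ(1) = 1₍₀₎ ⊗ (ε̄_t ⊗ ε_t)(1₍₁₎)`, where `ε̄_t ⊗ ε_t` is the
target map of `H^op ⊗ H`. -/
theorem weakHopf_comodule_algebra_structure
    {k H : Type*} [CommRing k] [Ring H] [Algebra k H] (WH : WeakHopf k H)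
    (Sinv : H →ₗ[k] H) (hSinv₁ : ∀ h : H, Sinv (WH.S h) = h)
    (hSinv₂ : ∀ h : H, WH.S (Sinv h) = h) :
    (∀ h : H, (TensorProduct.assoc k H (Hᵐᵒᵖ ⊗[k] H) (Hᵐᵒᵖ ⊗[k] H))
        (((weakHopfDoubleCoaction WH Sinv).rTensor (Hᵐᵒᵖ ⊗[k] H))
          (weakHopfDoubleCoaction WH Sinv h)) =
      (LinearMap.lTensor H (comulOpTensor WH.W)) (weakHopfDoubleCoaction WH Sinv h)) ∧
    (∀ h : H, (TensorProduct.rid k H)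
        ((LinearMap.lTensor H (counitOpTensor WH.W)) (weakHopfDoubleCoaction WH Sinv h)) = h) ∧
    (∀ h g : H, weakHopfDoubleCoaction WH Sinv (h * g) =
      weakHopfDoubleCoaction WH Sinv h * weakHopfDoubleCoaction WH Sinv g) ∧
    weakHopfDoubleCoaction WH Sinv 1 =
      (LinearMap.lTensor H (TensorProduct.map
        ((MulOpposite.opLinearEquiv k).toLinearMap ∘ₗ WH.W.εt' ∘ₗ
          (MulOpposite.opLinearEquiv k).symm.toLinearMap) WH.W.εt))
        (weakHopfDoubleCoaction WH Sinv 1) := by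
  exact ⟨LinearMap.congr_fun
      (weakHopfDoubleCoaction_coassoc WH (WH.comul_Sinv hSinv₁ hSinv₂)),
    weakHopfDoubleCoaction_counital WH (WH.counit_Sinv hSinv₂),
    weakHopfDoubleCoaction_mul WH (WH.Sinv_mul hSinv₁ hSinv₂),
    weakHopfDoubleCoaction_one WH (WH.εt'_Sinv_εs hSinv₁ hSinv₂)⟩
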